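/- For every conformal transformation τ of 𝕊², the mass and the center of mass satisfy M_τ² · (1 − |a_τ|²) = 1; equivalently, e^{4c_τ} = 1 − |a_τ|², where c_τ = −(1/2)ln M_τ. -/

import Mathlib

open MeasureTheory
open scoped Classical

noncomputable section

/-- Squared Euclidean norm on `ℝ²`. -/
def sq2 (x : ℝ × ℝ) : ℝ := x.1 ^ 2 + x.2 ^ 2

/-- Euclidean dot product on `ℝ³`. -/
def dot3 (a b : Fin 3 → ℝ) : ℝ := a 0 * b 0 + a 1 * b 1 + a 2 * b 2

/-- Squared Euclidean norm on `ℝ³`. -/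
def norm3sq (a : Fin 3 → ℝ) : ℝ := dot3 a a

/-- Stereographic projection from the north pole. -/
def SP (ω : Fin 3 → ℝ) : ℝ × ℝ := (ω 0 / (1 - ω 2), ω 1 / (1 - ω 2))

/-- Inverse stereographic projection. -/
def SPinv (x : ℝ × ℝ) : Fin 3 → ℝ :=
  ![2 * x.1 / (1 + sq2 x), 2 * x.2 / (1 + sq2 x), (sq2 x - 1) / (1 + sq2 x)]

/-- Identification `ℝ² ≅ ℂ`. -/
def cx (x : ℝ × ℝ) : ℂ := ⟨x.1, x.2⟩

/-- Identification `ℂ ≅ ℝ²`. -/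
def uncx (z : ℂ) : ℝ × ℝ := (z.re, z.im)

/-- The group `SL(2,ℂ)`. -/
abbrev SL2C := Matrix.SpecialLinearGroup (Fin 2) ℂ

/-- The Möbius transformation associated to `A ∈ SL(2,ℂ)`. -/
def TA (A : SL2C) (z : ℂ) : ℂ := (A.1 0 0 * z + A.1 0 1) / (A.1 1 0 * z + A.1 1 1)

/-- The north pole of `𝕊²`. -/
def northPole : Fin 3 → ℝ := ![0, 0, 1]

/-- The conformal transformation of `𝕊²` induced by `A ∈ SL(2,ℂ)` via stereographic
projection, extended continuously over the poles. -/
def tauA (A : SL2C) (ω : Fin 3 → ℝ) : Fin 3 → ℝ :=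
  if ω 2 = 1 then
    if A.1 1 0 = 0 then northPole else SPinv (uncx (A.1 0 0 / A.1 1 0))
  else if A.1 1 0 * cx (SP ω) + A.1 1 1 = 0 then northPole
  else SPinv (uncx (TA A (cx (SP ω))))

/-- The Jacobian `𝒥_{τ_A}(ω) = ((1+|z|²)/(|az+b|²+|cz+d|²))²`, `z = 𝒮(ω)`,
extended continuously over the north pole. -/
def jacA (A : SL2C) (ω : Fin 3 → ℝ) : ℝ :=
  if ω 2 = 1 then (1 / (Complex.normSq (A.1 0 0) + Complex.normSq (A.1 1 0))) ^ 2
  else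
    ((1 + Complex.normSq (cx (SP ω))) /
        (Complex.normSq (A.1 0 0 * cx (SP ω) + A.1 0 1) +
          Complex.normSq (A.1 1 0 * cx (SP ω) + A.1 1 1))) ^ 2

/-- `∫_{𝕊²} f dω = (1/π) ∫_{ℝ²} f(𝒮⁻¹(x)) (1+|x|²)⁻² dx`, the integral against the
normalized surface measure of `𝕊²`, written in stereographic coordinates. -/
def sphInt {E : Type*} [NormedAddCommGroup E] [NormedSpace ℝ E]
    (f : (Fin 3 → ℝ) → E) : E :=
  (1 / Real.pi) • ∫ x : ℝ × ℝ, ((1 + sq2 x)⁻¹) ^ 2 • f (SPinv x)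

/-- Integrability of `f : 𝕊² → ℝ` with respect to the normalized surface measure,
expressed in stereographic coordinates. -/
def SphIntegrable (f : (Fin 3 → ℝ) → ℝ) : Prop :=
  Integrable fun x : ℝ × ℝ => ((1 + sq2 x)⁻¹) ^ 2 * f (SPinv x)

/-- The mass `M_τ = ∫_{𝕊²} 𝒥_τ^{3/2} dω`. -/
def massA (A : SL2C) : ℝ := sphInt fun ω => jacA A ω ^ (3 / 2 : ℝ)

/-- The center of mass `a_τ = M_τ⁻¹ ∫_{𝕊²} ω 𝒥_τ^{3/2}(ω) dω`. -/
def comA (A : SL2C) : Fin 3 → ℝ :=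
  (massA A)⁻¹ • sphInt fun ω => jacA A ω ^ (3 / 2 : ℝ) • ω

/-- The normalizing constant `c_τ = -(1/2) ln M_τ`. -/
def cA (A : SL2C) : ℝ := -(1 / 2) * Real.log (massA A)

/-- `ψ_τ = (3/4) ln 𝒥_τ + c_τ`. -/
def psiA (A : SL2C) (ω : Fin 3 → ℝ) : ℝ := (3 / 4) * Real.log (jacA A ω) + cA A

/-- `|∇v(x)|²` for `v : ℝ² → ℝ`. -/
def gradSq (v : ℝ × ℝ → ℝ) (x : ℝ × ℝ) : ℝ :=
  fderiv ℝ v x (1, 0) ^ 2 + fderiv ℝ v x (0, 1) ^ 2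

/-- The Dirichlet energy `∫_{𝕊²} |∇_{𝕊²} u|² dω = (1/(4π)) ∫_{ℝ²} |∇(u∘𝒮⁻¹)(x)|² dx`. -/
def gradTerm (u : (Fin 3 → ℝ) → ℝ) : ℝ :=
  (1 / (4 * Real.pi)) * ∫ x : ℝ × ℝ, gradSq (fun y => u (SPinv y)) x

/-- Membership in the Sobolev space `H¹(𝕊²)`. -/
def MemH1 (u : (Fin 3 → ℝ) → ℝ) : Prop :=
  SphIntegrable u ∧ SphIntegrable (fun ω => u ω ^ 2) ∧
    Integrable fun x : ℝ × ℝ => gradSq (fun y => u (SPinv y)) x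

/-- The Chang–Gui functional `I_α`. -/
def CG (α : ℝ) (u : (Fin 3 → ℝ) → ℝ) : ℝ :=
  α * gradTerm u + 2 * sphInt u -
    (1 / 2) * Real.log
      ((sphInt fun ω => Real.exp (2 * u ω)) ^ 2 -
        norm3sq (sphInt fun ω => Real.exp (2 * u ω) • ω))

end

theorem aux_one_add_sq2_pos (x : ℝ × ℝ) : 0 < 1 + sq2 x := by
  unfold sq2; positivity

theorem aux_radial (n : ℕ) :
    ∫ r in Set.Ioi (0 : ℝ), r * ((1 + r ^ 2)⁻¹) ^ (n + 2) = 1 / (2 * (n + 1)) := by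
  have h := integral_Ioi_of_hasDerivAt_of_nonneg' (a := (0 : ℝ)) (l := 0)
    (g := fun r : ℝ => -(1 / (2 * ((n : ℝ) + 1))) * ((1 + r ^ 2)⁻¹) ^ (n + 1))
    (g' := fun r : ℝ => r * ((1 + r ^ 2)⁻¹) ^ (n + 2)) ?_ ?_ ?_
  · rw [h]; simp
  · intro r _
    have hp : (1 + r ^ 2 : ℝ) ≠ 0 := by positivity
    have hn : (n : ℝ) + 1 ≠ 0 := by positivity
    have h1 : HasDerivAt (fun r : ℝ => 1 + r ^ 2) (2 * r) r := by
      simpa using (hasDerivAt_pow 2 r).const_add 1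
    have h2 := ((h1.inv hp).pow (n + 1)).const_mul (-(1 / (2 * ((n : ℝ) + 1))))
    refine h2.congr_deriv ?_
    simp only [Pi.inv_apply, Nat.add_sub_cancel]
    push_cast
    have h3 : (1 + r ^ 2 : ℝ)⁻¹ ^ (n + 2) = (1 + r ^ 2 : ℝ)⁻¹ ^ n * ((1 + r ^ 2) ^ 2)⁻¹ := by
      rw [pow_add, inv_pow _ 2]
    rw [h3]
    field_simp
  · intro r hr
    have : (0 : ℝ) < r := hr
    positivity
  · have h1 : Filter.Tendsto (fun r : ℝ => (1 + r ^ 2)⁻¹) Filter.atTop (nhds 0) :=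
      Filter.Tendsto.inv_tendsto_atTop
        (Filter.tendsto_atTop_add_const_left _ _ (Filter.tendsto_pow_atTop (by norm_num)))
    simpa using (h1.pow (n + 1)).const_mul (-(1 / (2 * ((n : ℝ) + 1))))

theorem aux_plane (n : ℕ) :
    ∫ x : ℝ × ℝ, ((1 + sq2 x)⁻¹) ^ (n + 2) = Real.pi / (n + 1) := by
  rw [← integral_comp_polarCoord_symm]
  have h : ∀ q : ℝ × ℝ, q.1 • ((1 + sq2 (polarCoord.symm q))⁻¹) ^ (n + 2)
      = (q.1 * ((1 + q.1 ^ 2)⁻¹) ^ (n + 2)) * (fun _ : ℝ => (1 : ℝ)) q.2 := by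
    intro q
    have : sq2 (polarCoord.symm q) = q.1 ^ 2 := by
      simp only [sq2, polarCoord_symm_apply]
      linear_combination q.1 ^ 2 * Real.sin_sq_add_cos_sq q.2
    rw [this]; simp
  simp_rw [h]
  rw [polarCoord_target, Measure.volume_eq_prod,
    setIntegral_prod_mul (fun r : ℝ => r * ((1 + r ^ 2)⁻¹) ^ (n + 2))
      (fun _ : ℝ => (1 : ℝ)), aux_radial]
  simp [Real.pi_pos.le]
  field_simp
  ring

theorem aux_integrable2 : Integrable fun x : ℝ × ℝ => ((1 + sq2 x)⁻¹) ^ 2 := by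
  have h := integrable_rpow_neg_one_add_norm_sq (E := ℝ × ℝ) (μ := volume) (r := 4)
    (by simp; norm_num)
  refine h.mono' ?_ (Filter.Eventually.of_forall fun x => ?_)
  · refine Measurable.aestronglyMeasurable ?_
    unfold sq2; fun_prop
  · have hx := aux_one_add_sq2_pos x
    have hle : 1 + ‖x‖ ^ 2 ≤ 1 + sq2 x := by
      unfold sq2
      rw [Prod.norm_def]
      rcases max_cases ‖x.1‖ ‖x.2‖ with h | h <;> rw [h.1] <;> simp <;> positivity
    rw [Real.norm_of_nonneg (by positivity),
      show (-4 / 2 : ℝ) = -((2 : ℕ) : ℝ) by norm_num,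
      Real.rpow_neg (by positivity), Real.rpow_natCast, inv_pow]
    gcongr

theorem aux_integrable_of_le (f : ℝ × ℝ → ℝ) (hf : Measurable f)
    (h : ∀ x, |f x| ≤ 1 + sq2 x) :
    Integrable fun x : ℝ × ℝ => f x * ((1 + sq2 x)⁻¹) ^ 3 := by
  refine aux_integrable2.mono' ?_ (Filter.Eventually.of_forall fun x => ?_)
  · refine Measurable.aestronglyMeasurable ?_
    unfold sq2; fun_prop
  · have hx := aux_one_add_sq2_pos x
    rw [Real.norm_eq_abs, abs_mul, abs_of_pos (a := _ ^ 3) (by positivity)]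
    calc |f x| * ((1 + sq2 x)⁻¹) ^ 3 ≤ (1 + sq2 x) * ((1 + sq2 x)⁻¹) ^ 3 := by
          gcongr; exact h x
      _ = _ := by field_simp

theorem aux_odd (f : ℝ × ℝ → ℝ) (hf : ∀ x, f (-x) = - f x) :
    ∫ x : ℝ × ℝ, f x * ((1 + sq2 x)⁻¹) ^ 3 = 0 := by
  have h := integral_neg_eq_self (fun x : ℝ × ℝ => f x * ((1 + sq2 x)⁻¹) ^ 3) volume
  have e : ∀ x : ℝ × ℝ, sq2 (-x) = sq2 x := fun x => by simp [sq2]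
  simp only [hf, e, neg_mul, integral_neg] at h
  linarith

theorem aux_main (α β γ δ : ℝ) :
    Integrable (fun x : ℝ × ℝ =>
      (α + β * x.1 + γ * x.2 + δ * sq2 x) * ((1 + sq2 x)⁻¹) ^ 3) ∧
    ∫ x : ℝ × ℝ, (α + β * x.1 + γ * x.2 + δ * sq2 x) * ((1 + sq2 x)⁻¹) ^ 3
      = Real.pi / 2 * (α + δ) := by
  have i0 := (aux_integrable_of_le (fun _ => 1) (by fun_prop)
    (fun x => by simp [sq2]; positivity)).const_mul (α - δ)
  have i1 := (aux_integrable_of_le (fun x => x.1) (by fun_prop)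
    (fun x => by
      simp only [sq2]; rw [abs_le]
      constructor <;> nlinarith [sq_nonneg (x.1 + 1), sq_nonneg (x.1 - 1), sq_nonneg x.2,
        sq_nonneg x.1])).const_mul β
  have i2 := (aux_integrable_of_le (fun x => x.2) (by fun_prop)
    (fun x => by
      simp only [sq2]; rw [abs_le]
      constructor <;> nlinarith [sq_nonneg (x.2 + 1), sq_nonneg (x.2 - 1), sq_nonneg x.2,
        sq_nonneg x.1])).const_mul γ
  have i3 := aux_integrable2.const_mul δ
  have e : (fun x : ℝ × ℝ =>
      (α + β * x.1 + γ * x.2 + δ * sq2 x) * ((1 + sq2 x)⁻¹) ^ 3) = fun x : ℝ × ℝ =>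
      (α - δ) * (1 * ((1 + sq2 x)⁻¹) ^ 3) + β * (x.1 * ((1 + sq2 x)⁻¹) ^ 3)
        + γ * (x.2 * ((1 + sq2 x)⁻¹) ^ 3) + δ * ((1 + sq2 x)⁻¹) ^ 2 := by
    funext x
    have hx := (aux_one_add_sq2_pos x).ne'
    field_simp
    ring
  rw [e]
  refine ⟨((i0.add i1).add i2).add i3, ?_⟩
  rw [integral_add (by exact (i0.add i1).add i2) i3, integral_add (by exact i0.add i1) i2,
    integral_add i0 i1,
    integral_const_mul, integral_const_mul, integral_const_mul, integral_const_mul,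
    aux_odd (fun x => x.1) (fun x => rfl), aux_odd (fun x => x.2) (fun x => rfl)]
  have h0 := aux_plane 0
  have h1 := aux_plane 1
  norm_num at h0 h1
  simp only [one_mul, inv_pow]
  rw [integral_const_mul, h0, h1]
  ring

theorem aux_change {E : Type*} [NormedAddCommGroup E] [NormedSpace ℝ E]
    (f : ℝ × ℝ → E) (p : ℝ) (hp : 0 < p) (w : ℝ × ℝ) :
    ∫ x, f x = (p⁻¹ ^ 2) • ∫ t, f (p⁻¹ • t + w) := by
  have h1 := Measure.integral_comp_smul (volume : Measure (ℝ × ℝ)) (fun x => f (x + w)) p⁻¹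
  rw [h1, integral_add_right_eq_self f w, smul_smul]
  have : Module.finrank ℝ (ℝ × ℝ) = 2 := by simp
  rw [this, abs_of_pos (by positivity)]
  have : p⁻¹ ^ 2 * (p⁻¹ ^ 2)⁻¹ = 1 := by field_simp
  rw [this, one_smul]

theorem aux_SP (x : ℝ × ℝ) : SP (SPinv x) = x := by
  have hx := (aux_one_add_sq2_pos x).ne'
  have h : 1 - (sq2 x - 1) / (1 + sq2 x) = 2 / (1 + sq2 x) := by field_simp; ring
  simp only [SP, SPinv, Matrix.cons_val]
  rw [h]
  ext <;> field_simp

/-- The quadratic form appearing in the Jacobian. -/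
theorem aux_jac (A : SL2C) : ∃ p u v r : ℝ, 0 < p ∧ 0 < r ∧ p * r - u ^ 2 - v ^ 2 = 1 ∧
    ∀ x : ℝ × ℝ, jacA A (SPinv x) ^ (3 / 2 : ℝ)
      = ((1 + sq2 x) / (p * sq2 x + 2 * (u * x.1 + v * x.2) + r)) ^ 3 := by
  have hdet := A.2
  rw [Matrix.det_fin_two] at hdet
  have hre := congrArg Complex.re hdet
  have him := congrArg Complex.im hdet
  simp only [jacA, aux_SP]
  generalize A.1 0 0 = a at *
  generalize A.1 0 1 = b at *
  generalize A.1 1 0 = c at *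
  generalize A.1 1 1 = d at *
  obtain ⟨a1, a2⟩ := a
  obtain ⟨b1, b2⟩ := b
  obtain ⟨c1, c2⟩ := c
  obtain ⟨d1, d2⟩ := d
  simp at hre him
  have hpd : (a1 ^ 2 + a2 ^ 2 + c1 ^ 2 + c2 ^ 2) * (b1 ^ 2 + b2 ^ 2 + d1 ^ 2 + d2 ^ 2)
      - (a1 * b1 + a2 * b2 + c1 * d1 + c2 * d2) ^ 2
      - (a1 * b2 - a2 * b1 + c1 * d2 - c2 * d1) ^ 2 = 1 := by
    have : (a1 * d1 - a2 * d2 - (b1 * c1 - b2 * c2)) ^ 2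
      + (a1 * d2 + a2 * d1 - (b1 * c2 + b2 * c1)) ^ 2 = 1 := by rw [hre, him]; norm_num
    linear_combination this
  have hpr : 0 < (a1 ^ 2 + a2 ^ 2 + c1 ^ 2 + c2 ^ 2) * (b1 ^ 2 + b2 ^ 2 + d1 ^ 2 + d2 ^ 2) := by
    nlinarith [sq_nonneg (a1 * b1 + a2 * b2 + c1 * d1 + c2 * d2),
      sq_nonneg (a1 * b2 - a2 * b1 + c1 * d2 - c2 * d1)]
  have hp0 : 0 ≤ a1 ^ 2 + a2 ^ 2 + c1 ^ 2 + c2 ^ 2 := by positivity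
  have hr0 : 0 ≤ b1 ^ 2 + b2 ^ 2 + d1 ^ 2 + d2 ^ 2 := by positivity
  refine ⟨a1 ^ 2 + a2 ^ 2 + c1 ^ 2 + c2 ^ 2, a1 * b1 + a2 * b2 + c1 * d1 + c2 * d2,
    a1 * b2 - a2 * b1 + c1 * d2 - c2 * d1, b1 ^ 2 + b2 ^ 2 + d1 ^ 2 + d2 ^ 2,
    pos_of_mul_pos_left hpr hr0, pos_of_mul_pos_right hpr hp0, hpd, fun x => ?_⟩
  have hx := aux_one_add_sq2_pos x
  have hne : SPinv x 2 ≠ 1 := by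
    simp only [SPinv, Matrix.cons_val]
    intro h
    rw [div_eq_one_iff_eq hx.ne'] at h
    linarith
  rw [if_neg hne]
  have hN : 1 + Complex.normSq (cx x) = 1 + sq2 x := by
    simp [cx, Complex.normSq_apply, sq2]; ring
  have hD : Complex.normSq ((⟨a1, a2⟩ : ℂ) * cx x + ⟨b1, b2⟩)
      + Complex.normSq ((⟨c1, c2⟩ : ℂ) * cx x + ⟨d1, d2⟩)
      = (a1 ^ 2 + a2 ^ 2 + c1 ^ 2 + c2 ^ 2) * sq2 x
        + 2 * ((a1 * b1 + a2 * b2 + c1 * d1 + c2 * d2) * x.1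
          + (a1 * b2 - a2 * b1 + c1 * d2 - c2 * d1) * x.2)
        + (b1 ^ 2 + b2 ^ 2 + d1 ^ 2 + d2 ^ 2) := by
    simp [cx, Complex.normSq_apply, sq2]; ring
  rw [hN, ← hD]
  have hq : 0 ≤ (1 + sq2 x) / (Complex.normSq ((⟨a1, a2⟩ : ℂ) * cx x + ⟨b1, b2⟩)
      + Complex.normSq ((⟨c1, c2⟩ : ℂ) * cx x + ⟨d1, d2⟩)) :=
    div_nonneg hx.le (add_nonneg (Complex.normSq_nonneg _) (Complex.normSq_nonneg _))
  rw [← Real.rpow_natCast _ 2, ← Real.rpow_mul hq, ← Real.rpow_natCast _ 3]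
  norm_num

theorem aux_values (A : SL2C) : ∃ p u v r : ℝ, 0 < p ∧ 0 < r ∧ p * r - u ^ 2 - v ^ 2 = 1 ∧
    massA A = (p + r) / 2 ∧
    (sphInt fun ω => jacA A ω ^ (3 / 2 : ℝ) • ω) = ![-u, -v, (r - p) / 2] := by
  obtain ⟨p, u, v, r, hp, hr, hpr, hJ⟩ := aux_jac A
  refine ⟨p, u, v, r, hp, hr, hpr, ?_, ?_⟩
  all_goals
    have hpi := Real.pi_pos
    have hr' : r = (1 + u ^ 2 + v ^ 2) / p := by field_simp; linarith
  all_goals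
    have hD : ∀ t : ℝ × ℝ, p * sq2 (p⁻¹ • t + (-u / p, -v / p))
      + 2 * (u * (p⁻¹ • t + (-u / p, -v / p)).1 + v * (p⁻¹ • t + (-u / p, -v / p)).2) + r
      = (1 + sq2 t) / p := by
      intro t
      rw [hr']
      simp [sq2]
      field_simp
      ring
  all_goals
    have hS : ∀ t : ℝ × ℝ, sq2 (p⁻¹ • t + (-u / p, -v / p))
      = (sq2 t - 2 * (u * t.1 + v * t.2) + u ^ 2 + v ^ 2) / p ^ 2 := by
      intro t
      simp [sq2]
      field_simp
      ring
  · simp only [massA, sphInt, hJ]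
    rw [aux_change _ p hp (-u / p, -v / p)]
    have e : ∀ t : ℝ × ℝ, ((1 + sq2 (p⁻¹ • t + (-u / p, -v / p)))⁻¹) ^ 2 •
        ((1 + sq2 (p⁻¹ • t + (-u / p, -v / p))) / (p * sq2 (p⁻¹ • t + (-u / p, -v / p))
      + 2 * (u * (p⁻¹ • t + (-u / p, -v / p)).1 + v * (p⁻¹ • t + (-u / p, -v / p)).2) + r)) ^ 3
      = (p * (p ^ 2 + u ^ 2 + v ^ 2) + (-2 * p * u) * t.1 + (-2 * p * v) * t.2 + p * sq2 t)
        * ((1 + sq2 t)⁻¹) ^ 3 := by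
      intro t
      have h1 := (aux_one_add_sq2_pos (p⁻¹ • t + (-u / p, -v / p))).ne'
      have h2 := (aux_one_add_sq2_pos t).ne'
      rw [hD, smul_eq_mul]
      have h3 : 1 + sq2 (p⁻¹ • t + (-u / p, -v / p))
        = (p ^ 2 + sq2 t - 2 * (u * t.1 + v * t.2) + u ^ 2 + v ^ 2) / p ^ 2 := by
        rw [hS]; field_simp; ring
      calc _ = (1 + sq2 (p⁻¹ • t + (-u / p, -v / p))) * (p ^ 3 * ((1 + sq2 t)⁻¹) ^ 3) := by
            field_simp
        _ = _ := by rw [h3]; field_simp; ring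
    simp_rw [e]
    rw [(aux_main _ _ _ _).2, hr', smul_eq_mul, smul_eq_mul]
    field_simp
    ring
  · simp only [sphInt, hJ]
    rw [aux_change _ p hp (-u / p, -v / p)]
    have e : ∀ t : ℝ × ℝ, ((1 + sq2 (p⁻¹ • t + (-u / p, -v / p)))⁻¹) ^ 2 •
        ((1 + sq2 (p⁻¹ • t + (-u / p, -v / p))) / (p * sq2 (p⁻¹ • t + (-u / p, -v / p))
      + 2 * (u * (p⁻¹ • t + (-u / p, -v / p)).1 + v * (p⁻¹ • t + (-u / p, -v / p)).2) + r)) ^ 3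
        • SPinv (p⁻¹ • t + (-u / p, -v / p))
      = ![(-2 * p ^ 2 * u + 2 * p ^ 2 * t.1 + 0 * t.2 + 0 * sq2 t) * ((1 + sq2 t)⁻¹) ^ 3,
          (-2 * p ^ 2 * v + 0 * t.1 + 2 * p ^ 2 * t.2 + 0 * sq2 t) * ((1 + sq2 t)⁻¹) ^ 3,
          (p * (u ^ 2 + v ^ 2 - p ^ 2) + (-2 * p * u) * t.1 + (-2 * p * v) * t.2 + p * sq2 t)
        * ((1 + sq2 t)⁻¹) ^ 3] := by
      intro t
      have h1 := (aux_one_add_sq2_pos (p⁻¹ • t + (-u / p, -v / p))).ne'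
      have h2 := (aux_one_add_sq2_pos t).ne'
      rw [hD]
      have h4 : ∀ y : ℝ, ((1 + sq2 (p⁻¹ • t + (-u / p, -v / p)))⁻¹) ^ 2 *
        (((1 + sq2 (p⁻¹ • t + (-u / p, -v / p))) / ((1 + sq2 t) / p)) ^ 3
          * (y / (1 + sq2 (p⁻¹ • t + (-u / p, -v / p)))))
          = y * (p ^ 3 * ((1 + sq2 t)⁻¹) ^ 3) := by
        intro y
        generalize 1 + sq2 (p⁻¹ • t + (-u / p, -v / p)) = q at h1
        field_simp
      ext i
      fin_cases i
      · simp only [SPinv, Pi.smul_apply, smul_eq_mul, Fin.zero_eta, Matrix.cons_val]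
        rw [h4]
        simp
        field_simp
        ring
      · simp only [SPinv, Pi.smul_apply, smul_eq_mul, Fin.mk_one, Matrix.cons_val]
        rw [h4]
        simp
        field_simp
        ring
      · simp only [SPinv, Pi.smul_apply, smul_eq_mul, Fin.reduceFinMk, Matrix.cons_val]
        rw [h4, hS]
        field_simp
        ring
    simp_rw [e]
    ext i
    rw [Pi.smul_apply, Pi.smul_apply, eval_integral]
    · fin_cases i
      · simp only [Fin.zero_eta, Matrix.cons_val]
        rw [(aux_main _ _ _ _).2, smul_eq_mul, smul_eq_mul]
        field_simp
        ring
      · simp only [Fin.mk_one, Matrix.cons_val]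
        rw [(aux_main _ _ _ _).2, smul_eq_mul, smul_eq_mul]
        field_simp
        ring
      · simp only [Fin.reduceFinMk, Matrix.cons_val]
        rw [(aux_main _ _ _ _).2, hr', smul_eq_mul, smul_eq_mul]
        field_simp
        ring
    · intro i
      fin_cases i
      · simpa only [Fin.zero_eta, Matrix.cons_val] using (aux_main _ _ _ _).1
      · simpa only [Fin.mk_one, Matrix.cons_val] using (aux_main _ _ _ _).1
      · simpa only [Fin.reduceFinMk, Matrix.cons_val] using (aux_main _ _ _ _).1

/-- `M_τ² (1 − |a_τ|²) = 1`; equivalently `e^{4c_τ} = 1 − |a_τ|²`. -/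
theorem mass_com_relation (A : SL2C) :
    massA A ^ 2 * (1 - norm3sq (comA A)) = 1 ∧
    Real.exp (4 * cA A) = 1 - norm3sq (comA A) := by
  obtain ⟨p, u, v, r, hp, hr, hpr, hM, hV⟩ := aux_values A
  have hMpos : 0 < massA A := by rw [hM]; positivity
  have key : massA A ^ 2 * (1 - norm3sq (comA A)) = 1 := by
    have hc : comA A = (massA A)⁻¹ • ![-u, -v, (r - p) / 2] := by rw [comA, hV]
    rw [hc]
    simp only [norm3sq, dot3, Pi.smul_apply, smul_eq_mul, Matrix.cons_val]
    have : massA A ^ 2 - (u ^ 2 + v ^ 2 + ((r - p) / 2) ^ 2) = 1 := by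
      rw [hM]; linear_combination hpr
    field_simp
    linear_combination 4 * this
  refine ⟨key, ?_⟩
  have h1 : 4 * cA A = -Real.log (massA A ^ 2) := by
    rw [cA, Real.log_pow]; push_cast; ring
  rw [h1, Real.exp_neg, Real.exp_log (by positivity)]
  field_simp
  linarith
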